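/- There is an absolute constant c > 0 such that for all n ≥ 2, m ≥ 2 and rewards with r_0 = 0 and r_j ≥ 1 for all j ∈ {1,…,m−1}: every class C ⊆ C_bounded that is a 1/(24·n·m)-approximation of C_bounded satisfies PDim(C) ≥ c·m·log₂ n. In particular PDim(C_bounded) ≥ c·m·log₂ n and PDim(C_unbounded) ≥ c·m·log₂ n; moreover PDim(C_linear) ≥ c·log₂ n. -/

import Mathlib

open scoped BigOperators

/-- An agent type in the hidden-action principal-agent model with `n` actions and
`m` outcomes: a production function `f` (a distribution over outcomes for each action)
and a nonnegative cost vector `c` with `c 0 = 0`. -/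
structure AgentType (n m : ℕ) where
  f : Fin n → Fin m → ℝ
  c : Fin n → ℝ
  f_nonneg : ∀ i j, 0 ≤ f i j
  f_sum : ∀ i, ∑ j, f i j = 1
  c_nonneg : ∀ i, 0 ≤ c i
  c_zero : ∀ i : Fin n, (i : ℕ) = 0 → c i = 0

/-- The agent's expected utility for action `i` under contract `t`. -/
def uA {n m : ℕ} (θ : AgentType n m) (t : Fin m → ℝ) (i : Fin n) : ℝ :=
  (∑ j, θ.f i j * t j) - θ.c i

/-- The principal's expected utility when the agent takes action `i` under contract `t`,
with rewards `r`. -/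
def uPa {n m : ℕ} (r : Fin m → ℝ) (θ : AgentType n m) (t : Fin m → ℝ) (i : Fin n) : ℝ :=
  ∑ j, θ.f i j * (r j - t j)

/-- The set of the agent's best-response actions to contract `t`. -/
def BestResp {n m : ℕ} (θ : AgentType n m) (t : Fin m → ℝ) : Set (Fin n) :=
  {i | ∀ i', uA θ t i' ≤ uA θ t i}

/-- The principal's utility under contract `t`: the agent best-responds, breaking ties
in favor of the principal. -/
noncomputable def uP {n m : ℕ} (r : Fin m → ℝ) (θ : AgentType n m) (t : Fin m → ℝ) : ℝ :=
  sSup (uPa r θ t '' BestResp θ t)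

/-- The class of linear contracts `α • r`, `α ∈ [0,1]`. -/
def Clinear {m : ℕ} (r : Fin m → ℝ) : Set (Fin m → ℝ) :=
  {t | ∃ α : ℝ, α ∈ Set.Icc (0:ℝ) 1 ∧ t = fun j => α * r j}

/-- The class of bounded contracts `[0,1]^m`. -/
def Cbounded (m : ℕ) : Set (Fin m → ℝ) := {t | ∀ j, t j ∈ Set.Icc (0:ℝ) 1}

/-- The class of unbounded contracts `ℝ_{≥0}^m`. -/
def Cunbounded (m : ℕ) : Set (Fin m → ℝ) := {t | ∀ j, 0 ≤ t j}

/-- A finitely supported probability distribution. -/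
structure FinDist (α : Type*) where
  p : α → ℝ
  nonneg : ∀ a, 0 ≤ p a
  finite_support : (Function.support p).Finite
  total : ∑ᶠ a, p a = 1

/-- Expectation of `g` under a finitely supported distribution `D`. -/
noncomputable def expect {α : Type*} (D : FinDist α) (g : α → ℝ) : ℝ :=
  ∑ᶠ a, D.p a * g a

/-- `OPT(C, D)`: the supremum over contracts in `C` of the principal's expected utility. -/
noncomputable def OPT {n m : ℕ} (C : Set (Fin m → ℝ)) (r : Fin m → ℝ)
    (D : FinDist (AgentType n m)) : ℝ :=
  sSup ((fun t => expect D (fun θ => uP r θ t)) '' C)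

/-- Pseudo-dimension shattering: `C` shatters some `k` types in `Θ`. -/
def Shatters {n m : ℕ} (r : Fin m → ℝ) (C : Set (Fin m → ℝ))
    (Θ : Set (AgentType n m)) (k : ℕ) : Prop :=
  ∃ θ : Fin k → AgentType n m, (∀ j, θ j ∈ Θ) ∧ ∃ τ : Fin k → ℝ,
    ∀ S : Finset (Fin k), ∃ t ∈ C,
      (∀ j, j ∈ S → τ j ≤ uP r (θ j) t) ∧ (∀ j, j ∉ S → uP r (θ j) t < τ j)

/-- `Cbar` is an `ε`-approximation of `C` (representation error at most `ε`). -/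
def IsApprox (n : ℕ) {m : ℕ} (r : Fin m → ℝ) (Cbar C : Set (Fin m → ℝ)) (ε : ℝ) : Prop :=
  ∀ D : FinDist (AgentType n m), OPT Cbar r D ≥ OPT C r D - ε

/-- Best responses breaking ties in favor of the principal. -/
def BestRespP {n m : ℕ} (r : Fin m → ℝ) (θ : AgentType n m) (t : Fin m → ℝ) : Set (Fin n) :=
  {i | i ∈ BestResp θ t ∧ ∀ i' ∈ BestResp θ t, uPa r θ t i' ≤ uPa r θ t i}

/-- Principal's expected reward under the linear contract `α • r`. -/
noncomputable def rP {n m : ℕ} (r : Fin m → ℝ) (θ : AgentType n m) (α : ℝ) : ℝ :=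
  sSup ((fun i => ∑ j, θ.f i j * r j) '' BestRespP r θ (fun j => α * r j))

/-- The set of critical values of an agent type for linear contracts. -/
def CritSet {n m : ℕ} (r : Fin m → ℝ) (θ : AgentType n m) : Set ℝ :=
  {α | α ∈ Set.Ioc (0:ℝ) 1 ∧ ∀ ε : ℝ, 0 < ε → ε ≤ α → rP r θ (α - ε) ≠ rP r θ α}

/-- Probability of the event `E` under `N` i.i.d. samples from `D`. -/
noncomputable def prodProb {α : Type*} (D : FinDist α) (N : ℕ) (E : Set (Fin N → α)) : ℝ :=
  ∑ᶠ s ∈ E, ∏ i, D.p (s i)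

/-- The class of `ε`-discrete linear contracts. -/
def Leps {m : ℕ} (r : Fin m → ℝ) (ε : ℝ) : Set (Fin m → ℝ) :=
  {t | ∃ α : ℝ, ((∃ k : ℕ, α = k * ε ∧ k * ε ≤ 1) ∨ α = 1) ∧ t = fun j => α * r j}

section BestResponse

variable {n m : ℕ}

lemma uPa_le_uP (r : Fin m → ℝ) {θ : AgentType n m} {t : Fin m → ℝ} {i : Fin n}
    (hi : i ∈ BestResp θ t) : uPa r θ t i ≤ uP r θ t :=
  le_csSup (Set.toFinite _).bddAbove ⟨i, hi, rfl⟩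

lemma exists_bestResp_uP_eq (r : Fin m → ℝ) [Nonempty (Fin n)] (θ : AgentType n m)
    (t : Fin m → ℝ) : ∃ i ∈ BestResp θ t, uPa r θ t i = uP r θ t := by
  have hne : (BestResp θ t).Nonempty := Finite.exists_max (uA θ t)
  exact (hne.image (uPa r θ t)).csSup_mem (Set.toFinite _)

end BestResponse

/-- The type all of whose actions are supported on the outcomes `0` and `j`: action `i` reaches
outcome `j` with probability `p i` and costs `c i`. -/
noncomputable def binaryType {n m : ℕ} (j : Fin (m + 1)) (p c : Fin n → ℝ)
    (hp0 : ∀ i, 0 ≤ p i) (hp1 : ∀ i, p i ≤ 1) (hc : ∀ i, 0 ≤ c i)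
    (hc0 : ∀ i : Fin n, (i : ℕ) = 0 → c i = 0) : AgentType n (m + 1) where
  f i l := (if l = 0 then 1 - p i else 0) + (if l = j then p i else 0)
  c := c
  f_nonneg i l := by
    have := hp0 i
    have := hp1 i
    split_ifs <;> linarith
  f_sum i := by simp [Finset.sum_add_distrib]
  c_nonneg := hc
  c_zero := hc0

section BinaryType

variable {n m : ℕ} {j : Fin (m + 1)} {p c : Fin n → ℝ} {hp0 : ∀ i, 0 ≤ p i}
  {hp1 : ∀ i, p i ≤ 1} {hc : ∀ i, 0 ≤ c i} {hc0 : ∀ i : Fin n, (i : ℕ) = 0 → c i = 0}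

lemma uA_binaryType (t : Fin (m + 1) → ℝ) (i : Fin n) :
    uA (binaryType j p c hp0 hp1 hc hc0) t i = t 0 + p i * (t j - t 0) - c i := by
  simp only [uA, binaryType, add_mul, Finset.sum_add_distrib, ite_mul, zero_mul,
    Finset.sum_ite_eq', Finset.mem_univ, if_true]
  ring

lemma uPa_binaryType {r : Fin (m + 1) → ℝ} (hr : r 0 = 0) (t : Fin (m + 1) → ℝ) (i : Fin n) :
    uPa r (binaryType j p c hp0 hp1 hc hc0) t i = p i * (r j - (t j - t 0)) - t 0 := by
  simp only [uPa, binaryType, add_mul, Finset.sum_add_distrib, ite_mul, zero_mul,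
    Finset.sum_ite_eq', Finset.mem_univ, if_true, hr]
  ring

end BinaryType

/-- The type whose nonzero actions all lead to outcome `j` at cost `v`. -/
noncomputable def probeType (n : ℕ) {m : ℕ} (j : Fin (m + 1)) (v : ℝ) (hv : 0 ≤ v) :
    AgentType n (m + 1) :=
  binaryType j (fun i => if (i : ℕ) = 0 then 0 else 1) (fun i => if (i : ℕ) = 0 then 0 else v)
    (fun i => by split_ifs <;> simp) (fun i => by split_ifs <;> simp)
    (fun i => by split_ifs <;> simp [hv]) (fun i h => by simp [h])

section ProbeType

variable {n m : ℕ} {j : Fin (m + 1)} {v : ℝ} {hv : 0 ≤ v} {r t : Fin (m + 1) → ℝ}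

lemma uP_probeType_cases [NeZero n] (hr : r 0 = 0) :
    uP r (probeType n j v hv) t = -t 0 ∨
      v ≤ t j - t 0 ∧ uP r (probeType n j v hv) t = r j - t j := by
  obtain ⟨i, hi, he⟩ := exists_bestResp_uP_eq r (probeType n j v hv) t
  rw [← he, probeType, uPa_binaryType hr]
  by_cases h0 : (i : ℕ) = 0
  · left
    simp [h0]
  · right
    have h := hi 0
    rw [probeType, uA_binaryType, uA_binaryType] at h
    simp only [h0, if_false, Fin.val_zero, if_true] at h
    refine ⟨by linarith, ?_⟩
    simp only [h0, if_false]
    ring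

lemma uP_probeType_le [NeZero n] (hr : r 0 = 0) (hvr : v ≤ r j) (ht : 0 ≤ t 0) :
    uP r (probeType n j v hv) t ≤ r j - v := by
  rcases uP_probeType_cases (n := n) (hv := hv) (t := t) hr with h | ⟨h, h'⟩ <;> linarith

lemma le_uP_probeType (hn : 2 ≤ n) (hr : r 0 = 0) (ht0 : t 0 = 0) (htj : t j = v) :
    r j - v ≤ uP r (probeType n j v hv) t := by
  have hi : (⟨1, hn⟩ : Fin n) ∈ BestResp (probeType n j v hv) t := by
    intro i
    rw [probeType, uA_binaryType, uA_binaryType]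
    by_cases h : (i : ℕ) = 0 <;> simp [h, ht0, htj]
  refine le_trans (le_of_eq ?_) (uPa_le_uP r hi)
  rw [probeType, uPa_binaryType hr]
  simp [ht0, htj]

lemma mem_window_of_lt_uP_probeType [NeZero n] {δ : ℝ} (hr : r 0 = 0) (hvr : v + δ ≤ r j)
    (ht : 0 ≤ t 0) (h : r j - v - δ < uP r (probeType n j v hv) t) :
    t 0 ≤ δ ∧ v ≤ t j - t 0 ∧ t j - t 0 ≤ v + δ := by
  rcases uP_probeType_cases (n := n) (hv := hv) (t := t) hr with h' | ⟨h1, h'⟩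
  · linarith
  · refine ⟨?_, ?_, ?_⟩ <;> linarith

end ProbeType

/-- Left end point of the `x`-th window of width `δ`. -/
noncomputable def windowStart (δ : ℝ) (x : ℕ) : ℝ := δ * (5 * x + 2)

/-- The payment difference up to which the principal gains at least `R / 2` from the `x`-th
action of `combType`. It lies just after the `x`-th window if `x ∈ B`, and just before it
otherwise. -/
noncomputable def breakEven (δ : ℝ) (B : Set ℕ) (x : ℕ) : ℝ :=
  open Classical in windowStart δ x + if x ∈ B then 3 * δ else -δ

/-- Success probability of the `x`-th action of `combType`. -/
noncomputable def combProb (R δ : ℝ) (B : Set ℕ) (x : ℕ) : ℝ :=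
  R / 2 / (R - breakEven δ B x)

/-- Cost of the `x`-th action of `combType`, chosen so that the agent switches from action `l`
to action `l + 1` between the windows `l` and `l + 1`. -/
noncomputable def combCost (R δ : ℝ) (B : Set ℕ) (x : ℕ) : ℝ :=
  ∑ l ∈ Finset.range x,
    (windowStart δ (l + 1) - δ) * (combProb R δ B (l + 1) - combProb R δ B l)

section Comb

variable {n : ℕ} {R δ : ℝ} {B : Set ℕ}

lemma windowStart_add_le (hδ : 0 < δ) (hδn : δ * n * 12 = 1) {x : ℕ} (hx : x < n) :
    windowStart δ x + 3 * δ ≤ 1 / 2 := by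
  have hx' : (x : ℝ) + 1 ≤ n := by exact_mod_cast hx
  unfold windowStart
  nlinarith [mul_le_mul_of_nonneg_left hx' hδ.le]

lemma windowStart_nonneg (hδ : 0 < δ) (x : ℕ) : 0 ≤ windowStart δ x := by
  unfold windowStart
  positivity

lemma breakEven_le_half (hδ : 0 < δ) (hδn : δ * n * 12 = 1) {x : ℕ} (hx : x < n) :
    breakEven δ B x ≤ 1 / 2 := by
  have := windowStart_add_le hδ hδn hx
  unfold breakEven
  split_ifs <;> linarith

lemma breakEven_nonneg (hδ : 0 < δ) (x : ℕ) : 0 ≤ breakEven δ B x := by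
  have : 0 ≤ δ * (5 * (x : ℝ)) := by positivity
  unfold breakEven windowStart
  split_ifs <;> linarith

lemma breakEven_lt_succ (hδ : 0 < δ) (x : ℕ) : breakEven δ B x < breakEven δ B (x + 1) := by
  unfold breakEven windowStart
  push_cast
  split_ifs <;> linarith

lemma half_le_combProb (hR : 1 ≤ R) (hδ : 0 < δ) (hδn : δ * n * 12 = 1) {x : ℕ} (hx : x < n) :
    1 / 2 ≤ combProb R δ B x := by
  have h1 := breakEven_le_half (B := B) hδ hδn hx
  have h0 := breakEven_nonneg (B := B) hδ x
  unfold combProb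
  rw [le_div_iff₀ (by linarith)]
  linarith

lemma combProb_le_one (hR : 1 ≤ R) (hδ : 0 < δ) (hδn : δ * n * 12 = 1) {x : ℕ} (hx : x < n) :
    combProb R δ B x ≤ 1 := by
  have h1 := breakEven_le_half (B := B) hδ hδn hx
  unfold combProb
  rw [div_le_one (by linarith)]
  linarith

lemma combProb_mul (hR : 1 ≤ R) (hδ : 0 < δ) (hδn : δ * n * 12 = 1) {x : ℕ} (hx : x < n) :
    combProb R δ B x * (R - breakEven δ B x) = R / 2 := by
  have h1 := breakEven_le_half (B := B) hδ hδn hx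
  exact div_mul_cancel₀ _ (by linarith)

lemma combProb_lt_succ (hR : 1 ≤ R) (hδ : 0 < δ) (hδn : δ * n * 12 = 1) {x : ℕ}
    (hx : x + 1 < n) : combProb R δ B x < combProb R δ B (x + 1) := by
  have h1 := breakEven_le_half (B := B) hδ hδn hx
  have h2 := breakEven_lt_succ (B := B) hδ x
  exact div_lt_div_of_pos_left (by linarith) (by linarith) (by linarith)

lemma combCost_nonneg (hR : 1 ≤ R) (hδ : 0 < δ) (hδn : δ * n * 12 = 1) {x : ℕ} (hx : x < n) :
    0 ≤ combCost R δ B x := by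
  refine Finset.sum_nonneg fun l hl => mul_nonneg ?_ ?_
  · have : 0 ≤ δ * (5 * ((l + 1 : ℕ) : ℝ)) := by positivity
    unfold windowStart
    linarith
  · have := Finset.mem_range.1 hl
    exact sub_nonneg.2 (combProb_lt_succ hR hδ hδn (by omega)).le

lemma comb_utility_succ (s : ℝ) (x : ℕ) :
    combProb R δ B (x + 1) * s - combCost R δ B (x + 1) =
      combProb R δ B x * s - combCost R δ B x +
        (combProb R δ B (x + 1) - combProb R δ B x) * (s - (windowStart δ (x + 1) - δ)) := by
  rw [combCost, Finset.sum_range_succ, ← combCost]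
  ring

lemma comb_utility_lt_of_lt (hR : 1 ≤ R) (hδ : 0 < δ) (hδn : δ * n * 12 = 1) {x : ℕ}
    (hx : x < n) {s : ℝ} (hs : windowStart δ x ≤ s) {i : ℕ} (hi : i < x) :
    combProb R δ B i * s - combCost R δ B i < combProb R δ B x * s - combCost R δ B x := by
  induction x, hi using Nat.le_induction with
  | base =>
    have h := combProb_lt_succ (B := B) hR hδ hδn hx
    rw [comb_utility_succ s i]
    have := mul_pos (sub_pos.2 h) (show 0 < s - (windowStart δ (i + 1) - δ) by linarith)
    linarith
  | succ x _ ih =>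
    have hlt : windowStart δ x ≤ windowStart δ (x + 1) := by
      unfold windowStart
      push_cast
      linarith
    have h := combProb_lt_succ (B := B) hR hδ hδn hx
    rw [comb_utility_succ s x]
    have := mul_pos (sub_pos.2 h) (show 0 < s - (windowStart δ (x + 1) - δ) by linarith)
    linarith [ih (by omega) (hlt.trans hs)]

lemma comb_utility_lt_of_gt (hR : 1 ≤ R) (hδ : 0 < δ) (hδn : δ * n * 12 = 1) {x : ℕ} {s : ℝ}
    (hs : s ≤ windowStart δ x + δ) {i : ℕ} (hi : x < i) (hin : i < n) :
    combProb R δ B i * s - combCost R δ B i < combProb R δ B x * s - combCost R δ B x := by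
  have step : ∀ y, x ≤ y → y + 1 < n →
      combProb R δ B (y + 1) * s - combCost R δ B (y + 1) <
        combProb R δ B y * s - combCost R δ B y := by
    intro y hxy hy
    have hxy' : δ * (x : ℝ) ≤ δ * y := by gcongr
    have hneg : s - (windowStart δ (y + 1) - δ) < 0 := by
      unfold windowStart at hs ⊢
      push_cast
      linarith
    rw [comb_utility_succ s y]
    have := mul_neg_of_pos_of_neg
      (sub_pos.2 (combProb_lt_succ (B := B) hR hδ hδn hy)) hneg
    linarith
  induction i, hi using Nat.le_induction with
  | base => exact step x le_rfl hin
  | succ i hxi ih => exact (step i (by omega) hin).trans (ih (by omega))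

end Comb

/-- A type whose induced principal utility, as a function of the payment difference between the
outcomes `j` and `0`, exceeds `R / 2` on exactly those windows whose index belongs to `B`. -/
noncomputable def combType {n m : ℕ} (j : Fin (m + 1)) {R δ : ℝ} (hR : 1 ≤ R) (hδ : 0 < δ)
    (hδn : δ * n * 12 = 1) (B : Set ℕ) : AgentType n (m + 1) :=
  binaryType j (fun i => combProb R δ B i) (fun i => combCost R δ B i)
    (fun i => by linarith [half_le_combProb (B := B) hR hδ hδn i.2])
    (fun i => combProb_le_one hR hδ hδn i.2)
    (fun i => combCost_nonneg hR hδ hδn i.2)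
    (fun i h => by simp [h, combCost])

section CombType

variable {n m : ℕ} {j : Fin (m + 1)} {δ : ℝ} {B : Set ℕ} {r t : Fin (m + 1) → ℝ}

lemma uP_combType (hR : 1 ≤ r j) (hδ : 0 < δ) (hδn : δ * n * 12 = 1) (hr : r 0 = 0) {x : ℕ}
    (hx : x < n) (h1 : windowStart δ x ≤ t j - t 0) (h2 : t j - t 0 ≤ windowStart δ x + δ) :
    uP r (combType j hR hδ hδn B) t =
      combProb (r j) δ B x * (r j - (t j - t 0)) - t 0 := by
  have : Nonempty (Fin n) := ⟨⟨x, hx⟩⟩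
  obtain ⟨i, hi, he⟩ := exists_bestResp_uP_eq r (combType j hR hδ hδn B) t
  have h := hi ⟨x, hx⟩
  rw [combType, uA_binaryType, uA_binaryType] at h
  have hix : (i : ℕ) = x := by
    by_contra hne
    rcases lt_or_gt_of_ne hne with hlt | hgt
    · linarith [comb_utility_lt_of_lt (B := B) hR hδ hδn hx h1 hlt]
    · linarith [comb_utility_lt_of_gt (B := B) hR hδ hδn h2 hgt i.2]
  rw [← he, combType, uPa_binaryType hr, hix]

lemma half_le_uP_combType (hR : 1 ≤ r j) (hδ : 0 < δ) (hδn : δ * n * 12 = 1) (hr : r 0 = 0)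
    {x : ℕ} (hx : x < n) (h0 : t 0 ≤ δ) (h1 : windowStart δ x ≤ t j - t 0)
    (h2 : t j - t 0 ≤ windowStart δ x + δ) (hxB : x ∈ B) :
    r j / 2 ≤ uP r (combType j hR hδ hδn B) t := by
  have hb : breakEven δ B x = windowStart δ x + 3 * δ := by simp [breakEven, hxB]
  rw [uP_combType hR hδ hδn hr hx h1 h2, ← combProb_mul (B := B) hR hδ hδn hx]
  have hp := half_le_combProb (B := B) hR hδ hδn hx
  have := mul_le_mul hp (show 2 * δ ≤ breakEven δ B x - (t j - t 0) by linarith)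
    (by linarith) (by linarith)
  linarith

lemma uP_combType_lt_half (hR : 1 ≤ r j) (hδ : 0 < δ) (hδn : δ * n * 12 = 1) (hr : r 0 = 0)
    {x : ℕ} (hx : x < n) (ht : 0 ≤ t 0) (h1 : windowStart δ x ≤ t j - t 0)
    (h2 : t j - t 0 ≤ windowStart δ x + δ) (hxB : x ∉ B) :
    uP r (combType j hR hδ hδn B) t < r j / 2 := by
  have hb : breakEven δ B x = windowStart δ x - δ := by simp [breakEven, hxB, sub_eq_add_neg]
  rw [uP_combType hR hδ hδn hr hx h1 h2, ← combProb_mul (B := B) hR hδ hδn hx]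
  have hp := half_le_combProb (B := B) hR hδ hδn hx
  have := mul_pos (show 0 < combProb (r j) δ B x by linarith)
    (show 0 < t j - t 0 - breakEven δ B x by linarith)
  linarith

end CombType

section Shatters

variable {n m : ℕ} {r : Fin m → ℝ} {C C' : Set (Fin m → ℝ)}

lemma Shatters.mono {Θ : Set (AgentType n m)} {k : ℕ} (h : Shatters r C Θ k) (hC : C ⊆ C') :
    Shatters r C' Θ k := by
  obtain ⟨θ, hθ, τ, h⟩ := h
  refine ⟨θ, hθ, τ, fun S => ?_⟩
  obtain ⟨t, ht, h⟩ := h S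
  exact ⟨t, hC ht, h⟩

lemma shatters_of_fintype {κ : Type*} [Fintype κ] (θ : κ → AgentType n m) (τ : κ → ℝ)
    (h : ∀ S : Set κ, ∃ t ∈ C,
      (∀ a ∈ S, τ a ≤ uP r (θ a) t) ∧ (∀ a ∉ S, uP r (θ a) t < τ a)) :
    Shatters r C (Set.univ : Set (AgentType n m)) (Fintype.card κ) := by
  let e := Fintype.equivFin κ
  refine ⟨fun i => θ (e.symm i), fun _ => Set.mem_univ _, fun i => τ (e.symm i), fun S => ?_⟩
  obtain ⟨t, ht, h1, h2⟩ := h {a | e a ∈ S}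
  exact ⟨t, ht, fun i hi => h1 _ (by simpa using hi), fun i hi => h2 _ (by simpa using hi)⟩

end Shatters

/-- If the contracts in `C` can realize any combination of windows on the outcomes `o a`, then
`C` shatters about `log₂ n` types per such outcome. -/
lemma shatters_of_windows {n m : ℕ} (hn : n ≠ 0) {ι : Type*} [Fintype ι]
    (o : ι → Fin (m + 1)) {r : Fin (m + 1) → ℝ} (hr0 : r 0 = 0) (hr : ∀ a, 1 ≤ r (o a))
    {δ : ℝ} (hδ : 0 < δ) (hδn : δ * n * 12 = 1) {C : Set (Fin (m + 1) → ℝ)}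
    (hC : ∀ x : ι → ℕ, (∀ a, x a < n) → ∃ t ∈ C, 0 ≤ t 0 ∧ t 0 ≤ δ ∧
      ∀ a, windowStart δ (x a) ≤ t (o a) - t 0 ∧
        t (o a) - t 0 ≤ windowStart δ (x a) + δ) :
    Shatters r C (Set.univ : Set (AgentType n (m + 1))) (Fintype.card ι * Nat.log 2 n) := by
  classical
  let k := Nat.log 2 n
  let e : Finset (Fin k) ≃ Fin (2 ^ k) := Fintype.equivFinOfCardEq (by simp)
  have he : ∀ s, (e s : ℕ) < n := fun s => (e s).2.trans_le (Nat.pow_log_le_self 2 hn)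
  let B : Fin k → Set ℕ := fun b => {x | ∃ s, (e s : ℕ) = x ∧ b ∈ s}
  have hB : ∀ b s, (e s : ℕ) ∈ B b ↔ b ∈ s := by
    refine fun b s => ⟨?_, fun h => ⟨s, rfl, h⟩⟩
    rintro ⟨s', hs', hb⟩
    rwa [← e.injective (Fin.ext hs')]
  have hcard : Fintype.card ι * Nat.log 2 n = Fintype.card (ι × Fin k) := by simp [k]
  rw [hcard]
  refine shatters_of_fintype (fun a => combType (o a.1) (hr a.1) hδ hδn (B a.2))
    (fun a => r (o a.1) / 2) fun S => ?_
  let x : ι → Finset (Fin k) := fun a => Finset.univ.filter fun b => (a, b) ∈ S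
  obtain ⟨t, ht, h0, h0', hw⟩ := hC (fun a => e (x a)) fun a => he _
  refine ⟨t, ht, fun a ha => ?_, fun a ha => ?_⟩
  · exact half_le_uP_combType _ hδ hδn hr0 (he _) h0' (hw a.1).1 (hw a.1).2
      ((hB _ _).2 (by simpa [x] using ha))
  · exact uP_combType_lt_half _ hδ hδn hr0 (he _) h0 (hw a.1).1 (hw a.1).2
      (fun h => ha (by simpa [x] using (hB _ _).1 h))

lemma exists_finDist_expect_eq {ι α : Type*} [Fintype ι] [Nonempty ι] (φ : ι → α) :
    ∃ D : FinDist α, ∀ g : α → ℝ, expect D g = (∑ a, g (φ a)) / Fintype.card ι := by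
  classical
  let p : α → ℝ := fun x => ∑ a, if φ a = x then (Fintype.card ι : ℝ)⁻¹ else 0
  have hsupp : Function.support p ⊆ (Finset.univ.image φ : Finset α) := by
    intro x hx
    obtain ⟨a, -, ha⟩ := Finset.exists_ne_zero_of_sum_ne_zero (Function.mem_support.1 hx)
    have : φ a = x := by
      by_contra h
      simp [h] at ha
    simp [← this]
  have key : ∀ g : α → ℝ, ∑ᶠ x, p x * g x = (∑ a, g (φ a)) / Fintype.card ι := by
    intro g
    rw [finsum_eq_sum_of_support_subset (s := Finset.univ.image φ) _
      ((Function.support_mul_subset_left _ _).trans hsupp)]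
    simp only [p, Finset.sum_mul, ite_mul, zero_mul]
    rw [Finset.sum_comm, Finset.sum_div]
    refine Finset.sum_congr rfl fun a _ => ?_
    rw [Finset.sum_ite_eq, if_pos (Finset.mem_image_of_mem _ (Finset.mem_univ a))]
    rw [div_eq_inv_mul]
  refine ⟨⟨p, fun x => Finset.sum_nonneg fun a _ => ?_,
    (Finset.finite_toSet _).subset hsupp, ?_⟩, key⟩
  · split_ifs <;> positivity
  · simpa using key fun _ => 1

/-- Good approximations of the bounded contracts realize all combinations of windows. -/
lemma exists_mem_windows_of_isApprox {n m : ℕ} (hn : 2 ≤ n) (hm : m ≠ 0)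
    {r : Fin (m + 1) → ℝ} (hr0 : r 0 = 0) (hr : ∀ a : Fin m, 1 ≤ r a.succ)
    {δ : ℝ} (hδ : 0 < δ) (hδn : δ * n * 12 = 1) {C : Set (Fin (m + 1) → ℝ)}
    (hCb : C ⊆ Cbounded (m + 1))
    (hC : IsApprox n r C (Cbounded (m + 1)) (1 / (24 * n * (m + 1 : ℕ))))
    (x : Fin m → ℕ) (hx : ∀ a, x a < n) :
    ∃ t ∈ C, 0 ≤ t 0 ∧ t 0 ≤ δ ∧ ∀ a : Fin m,
      windowStart δ (x a) ≤ t a.succ - t 0 ∧ t a.succ - t 0 ≤ windowStart δ (x a) + δ := by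
  have : NeZero n := ⟨by omega⟩
  have : Nonempty (Fin m) := ⟨⟨0, Nat.pos_of_ne_zero hm⟩⟩
  have hm0 : (0 : ℝ) < m := by exact_mod_cast Nat.pos_of_ne_zero hm
  have hn2 : (2 : ℝ) ≤ n := by exact_mod_cast hn
  have hv : ∀ a, 0 ≤ windowStart δ (x a) := fun a => windowStart_nonneg hδ _
  have hv' : ∀ a, windowStart δ (x a) + 3 * δ ≤ 1 / 2 := fun a =>
    windowStart_add_le hδ hδn (hx a)
  let φ : Fin m → AgentType n (m + 1) := fun a => probeType n a.succ _ (hv a)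
  obtain ⟨D, hD⟩ := exists_finDist_expect_eq φ
  simp only [Fintype.card_fin] at hD
  let V : ℝ := ∑ a : Fin m, (r a.succ - windowStart δ (x a))
  have hVm : (m : ℝ) * (1 / 2) ≤ V := by
    have := Finset.card_nsmul_le_sum (Finset.univ : Finset (Fin m))
      (fun a => r a.succ - windowStart δ (x a)) (1 / 2)
      fun a _ => by linarith [hr a, hv' a]
    rwa [Finset.card_univ, Fintype.card_fin, nsmul_eq_mul] at this
  have hle : ∀ t ∈ Cbounded (m + 1), ∀ a,
      uP r (φ a) t ≤ r a.succ - windowStart δ (x a) := fun t ht a =>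
    uP_probeType_le hr0 (by linarith [hr a, hv' a]) (ht 0).1
  have hOPT : V / m ≤ OPT (Cbounded (m + 1)) r D := by
    let t : Fin (m + 1) → ℝ := Fin.cons 0 fun a => windowStart δ (x a)
    have ht : t ∈ Cbounded (m + 1) := by
      refine Fin.cases (by simp [t]) fun a => ?_
      exact ⟨by simpa [t] using hv a, by simpa [t] using (by linarith [hv' a])⟩
    have hVt : V / m ≤ expect D fun θ => uP r θ t := by
      rw [hD]
      gcongr
      exact Finset.sum_le_sum fun a _ => le_uP_probeType hn hr0 rfl rfl
    refine hVt.trans (le_csSup ⟨V / m, ?_⟩ ⟨t, ht, rfl⟩)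
    rintro _ ⟨t, ht, rfl⟩
    change expect D (fun θ => uP r θ t) ≤ _
    rw [hD]
    gcongr
    exact Finset.sum_le_sum fun a _ => hle t ht a
  have hε : 2 * (1 / (24 * n * ((m + 1 : ℕ) : ℝ))) < δ / m := by
    have hδ' : δ = 1 / (12 * n) := by
      rw [eq_div_iff (by positivity)]
      linarith
    rw [hδ', div_div, mul_one_div, div_lt_div_iff₀ (by positivity) (by positivity)]
    push_cast
    nlinarith
  have hm1 : (1 : ℝ) ≤ m := by exact_mod_cast Nat.pos_of_ne_zero hm
  have hδ1 : δ ≤ 1 / 2 := by nlinarith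
  set ε := 1 / (24 * n * ((m + 1 : ℕ) : ℝ))
  have hε0 : 0 < ε := by positivity
  have hA := hC D
  have hlt : V / m - δ / m < OPT C r D := by linarith
  have hne : ((fun t => expect D (fun θ => uP r θ t)) '' C).Nonempty := by
    by_contra h
    rw [Set.not_nonempty_iff_eq_empty] at h
    rw [OPT, h, Real.sSup_empty, ← sub_div, div_lt_iff₀ hm0] at hlt
    linarith
  obtain ⟨_, ⟨t, ht, rfl⟩, hval⟩ := exists_lt_of_lt_csSup hne hlt
  have ht0 := (hCb ht 0).1
  have hwin : ∀ a : Fin m, t 0 ≤ δ ∧ windowStart δ (x a) ≤ t a.succ - t 0 ∧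
      t a.succ - t 0 ≤ windowStart δ (x a) + δ := by
    intro a
    refine mem_window_of_lt_uP_probeType (n := n) (hv := hv a) hr0
      (by linarith [hr a, hv' a]) ht0 ?_
    have hval' : V / m - δ / m < expect D (fun θ => uP r θ t) := hval
    rw [hD, ← sub_div, div_lt_div_iff_of_pos_right hm0] at hval'
    by_contra hcon
    have : ∑ b, (uP r (φ b) t + if b = a then δ else 0) ≤ V := by
      refine Finset.sum_le_sum fun b _ => ?_
      split_ifs with hb
      · subst hb
        linarith
      · simpa using hle t (hCb ht) b
    rw [Finset.sum_add_distrib] at this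
    rw [Finset.sum_ite_eq' Finset.univ a, if_pos (Finset.mem_univ a)] at this
    linarith
  exact ⟨t, ht, ht0, (hwin ⟨0, Nat.pos_of_ne_zero hm⟩).1, fun a => (hwin a).2⟩

lemma logb_two_le_two_mul_log {n : ℕ} (hn : 2 ≤ n) : Real.logb 2 n ≤ 2 * (Nat.log 2 n : ℝ) := by
  have h1 : 1 ≤ Nat.log 2 n := Nat.log_pos (by norm_num) hn
  have h2 : n ≤ 2 ^ (2 * Nat.log 2 n) :=
    (Nat.lt_pow_succ_log_self (by norm_num) n).le.trans
      (Nat.pow_le_pow_right (by norm_num) (by omega))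
  have hn0 : (0 : ℝ) < n := by exact_mod_cast (by omega : 0 < n)
  rw [Real.logb_le_iff_le_rpow (by norm_num) hn0]
  have h3 : (n : ℝ) ≤ 2 ^ (2 * Nat.log 2 n) := by exact_mod_cast h2
  rw [← Real.rpow_natCast] at h3
  simpa using h3

/-- There is an absolute constant `c > 0` such that for `n, m ≥ 2` with
`r 0 = 0` and `r j ≥ 1` for `j ≠ 0`: every `1/(24·n·m)`-approximation `C ⊆ C_bounded`
of `C_bounded` satisfies `PDim(C) ≥ c·m·log₂ n`; in particular `PDim(C_bounded)` and
`PDim(C_unbounded)` are at least `c·m·log₂ n`, and `PDim(C_linear) ≥ c·log₂ n`. -/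
theorem stmt_8 : ∃ c : ℝ, 0 < c ∧
    ∀ (n m : ℕ), 2 ≤ n → 2 ≤ m → ∀ r : Fin m → ℝ,
      (∀ j, 0 ≤ r j) → (∀ j : Fin m, (j : ℕ) = 0 → r j = 0) →
      (∀ j : Fin m, (j : ℕ) ≠ 0 → 1 ≤ r j) →
      ((∀ C : Set (Fin m → ℝ), C ⊆ Cbounded m →
          IsApprox n r C (Cbounded m) (1 / (24 * n * m)) →
          ∃ d : ℕ, Shatters r C (Set.univ : Set (AgentType n m)) d ∧
            c * m * Real.logb 2 n ≤ (d : ℝ)) ∧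
       (∃ d : ℕ, Shatters r (Cbounded m) (Set.univ : Set (AgentType n m)) d ∧
          c * m * Real.logb 2 n ≤ (d : ℝ)) ∧
       (∃ d : ℕ, Shatters r (Cunbounded m) (Set.univ : Set (AgentType n m)) d ∧
          c * m * Real.logb 2 n ≤ (d : ℝ)) ∧
       (∃ d : ℕ, Shatters r (Clinear r) (Set.univ : Set (AgentType n m)) d ∧
          c * Real.logb 2 n ≤ (d : ℝ))) := by
  refine ⟨1 / 4, by norm_num, fun n m hn hm r _ hr0 hr1 => ?_⟩
  obtain ⟨m, rfl⟩ : ∃ m', m = m' + 1 := ⟨m - 1, by omega⟩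
  have hm0 : m ≠ 0 := by omega
  have hn0 : (0 : ℝ) < n := by exact_mod_cast (by omega : 0 < n)
  have hm1 : (1 : ℝ) ≤ m := by exact_mod_cast (by omega : 1 ≤ m)
  have hr0' : r 0 = 0 := hr0 0 rfl
  have hrs : ∀ a : Fin m, 1 ≤ r a.succ := fun a => hr1 _ (by simp)
  have hlog := logb_two_le_two_mul_log hn
  have hδ : (0 : ℝ) < 1 / (12 * n) := by positivity
  have hδn : (1 : ℝ) / (12 * n) * n * 12 = 1 := by field_simp
  have happrox : ∀ C : Set (Fin (m + 1) → ℝ), C ⊆ Cbounded (m + 1) →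
      IsApprox n r C (Cbounded (m + 1)) (1 / (24 * n * (m + 1 : ℕ))) →
      ∃ d : ℕ, Shatters r C (Set.univ : Set (AgentType n (m + 1))) d ∧
        1 / 4 * ((m + 1 : ℕ) : ℝ) * Real.logb 2 n ≤ (d : ℝ) := by
    intro C hCb hC
    refine ⟨_, shatters_of_windows (by omega) Fin.succ hr0' hrs hδ hδn
      (exists_mem_windows_of_isApprox hn hm0 hr0' hrs hδ hδn hCb hC), ?_⟩
    simp only [Fintype.card_fin]
    push_cast
    calc 1 / 4 * ((m : ℝ) + 1) * Real.logb 2 n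
        ≤ 1 / 4 * ((m : ℝ) + 1) * (2 * (Nat.log 2 n : ℝ)) := by gcongr
      _ ≤ 1 / 4 * ((m : ℝ) + m) * (2 * (Nat.log 2 n : ℝ)) := by gcongr
      _ = m * Nat.log 2 n := by ring
  obtain ⟨d, hd, hd'⟩ := happrox _ subset_rfl fun D => sub_le_self _ (by positivity)
  refine ⟨happrox, ⟨d, hd, hd'⟩, ⟨d, hd.mono fun t ht j => (ht j).1, hd'⟩, ?_⟩
  let j : Fin m := ⟨0, Nat.pos_of_ne_zero hm0⟩
  have hj : 0 < r j.succ := by linarith [hrs j]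
  refine ⟨_, shatters_of_windows (by omega) (fun _ : Unit => j.succ) hr0' (fun _ => hrs j) hδ hδn
    fun x hx => ?_, ?_⟩
  · have hw := windowStart_add_le hδ hδn (hx ())
    have hw0 := windowStart_nonneg hδ (x ())
    refine ⟨fun l => windowStart (1 / (12 * n)) (x ()) / r j.succ * r l, ⟨_, ⟨?_, ?_⟩, rfl⟩, ?_⟩
    · positivity
    · rw [div_le_one hj]
      linarith [hrs j]
    · simp only [hr0', mul_zero, sub_zero, div_mul_cancel₀ _ hj.ne']
      exact ⟨le_rfl, hδ.le, fun _ => ⟨le_rfl, by linarith⟩⟩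
  · simp only [Fintype.card_unit, one_mul]
    linarith
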